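/- With the setup and the definitions of A(r) and B(r) below, every ν_i(r) (i ≥ −1) and every d_l(r) lies in (1/q)·ℤ ∩ (0,1], and consequently q²·A(r) and q²·B(r) are rational integers. -/

import Mathlib

/-- `⟨x⟩`: the unique element of `(0,1]` congruent to `x` modulo `ℤ`. -/
noncomputable def ufrac (x : ℝ) : ℝ := x - ⌈x⌉ + 1

/-- `[x]₁ := x - ⟨x⟩`. -/
noncomputable def ipart (x : ℝ) : ℝ := x - ufrac x

/-- The first Bernoulli polynomial `B₁(x) = x - 1/2`. -/
noncomputable def B1 (x : ℝ) : ℝ := x - 1/2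

/-- The second Bernoulli polynomial `B₂(x) = x² - x + 1/6`. -/
noncomputable def B2 (x : ℝ) : ℝ := x^2 - x + 1/6

theorem ufrac_pos (x : ℝ) : 0 < ufrac x := by
  have := Int.ceil_lt_add_one x
  unfold ufrac
  linarith

theorem ufrac_le_one (x : ℝ) : ufrac x ≤ 1 := by
  have := Int.le_ceil x
  unfold ufrac
  linarith

theorem ipart_eq_ceil_sub_one (x : ℝ) : ipart x = ((⌈x⌉ - 1 : ℤ) : ℝ) := by
  unfold ipart ufrac
  push_cast
  ring

/-- A real number with denominator `q` keeps this denominator under `ufrac`. -/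
theorem exists_ufrac_eq_div {q : ℕ} (hq : 0 < q) {x : ℝ} (hx : ∃ z : ℤ, x = (z : ℝ) / q) :
    ∃ z : ℤ, ufrac x = (z : ℝ) / q := by
  obtain ⟨z, hz⟩ := hx
  have hq' : (q : ℝ) ≠ 0 := by positivity
  refine ⟨z - ⌈x⌉ * q + q, ?_⟩
  unfold ufrac
  push_cast
  field_simp
  rw [hz]
  field_simp

theorem exists_sq_mul_B1_mul_B1_eq {q : ℕ} (hq : 0 < q) {x y : ℝ}
    (hx : ∃ z : ℤ, x = (z : ℝ) / q) (hy : ∃ z : ℤ, y = (z : ℝ) / q) :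
    ∃ z : ℤ, (q : ℝ) ^ 2 * (12 * B1 x * B1 y) = z := by
  obtain ⟨X, rfl⟩ := hx
  obtain ⟨Y, rfl⟩ := hy
  have hq' : (q : ℝ) ≠ 0 := by positivity
  refine ⟨3 * (2 * X - q) * (2 * Y - q), ?_⟩
  unfold B1
  push_cast
  field_simp
  ring

theorem exists_sq_mul_B2_eq {q : ℕ} (hq : 0 < q) {x : ℝ} (hx : ∃ z : ℤ, x = (z : ℝ) / q) :
    ∃ z : ℤ, (q : ℝ) ^ 2 * (6 * B2 x) = z := by
  obtain ⟨X, rfl⟩ := hx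
  have hq' : (q : ℝ) ≠ 0 := by positivity
  refine ⟨6 * X ^ 2 - 6 * X * q + q ^ 2, ?_⟩
  unfold B2
  push_cast
  field_simp

/-- The quadratic expression in `d` with integral weights has denominator `q²`. -/
theorem exists_sq_mul_quadratic_eq {q : ℕ} (hq : 0 < q) {d : ℝ}
    (hd : ∃ z : ℤ, d = (z : ℝ) / q) (m : ℤ) (x : ℝ) :
    ∃ z : ℤ, (q : ℝ) ^ 2 * (m * d ^ 2 + (1 - 2 * d) * ipart x) = z := by
  obtain ⟨E, rfl⟩ := hd
  have hq' : (q : ℝ) ≠ 0 := by positivity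
  refine ⟨m * E ^ 2 + (q ^ 2 - 2 * E * q) * (⌈x⌉ - 1), ?_⟩
  rw [ipart_eq_ceil_sub_one]
  push_cast
  field_simp

theorem exists_mul_sum_add_sum_eq (k : ℝ) (s₁ s₂ : Finset ℕ) (f g : ℕ → ℝ)
    (hf : ∀ l, ∃ z : ℤ, k * f l = z) (hg : ∀ l, ∃ z : ℤ, k * g l = z) :
    ∃ z : ℤ, k * (∑ l ∈ s₁, f l + ∑ l ∈ s₂, g l) = z := by
  choose F hF using hf
  choose G hG using hg
  refine ⟨∑ l ∈ s₁, F l + ∑ l ∈ s₂, G l, ?_⟩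
  push_cast
  simp only [mul_add, Finset.mul_sum, hF, hG]

/-- Integrality: every `ν_i(r)` (`i ≥ -1`) and every `d_l(r)` lies in `(1/q)ℤ ∩ (0,1]`,
and consequently `q²·A(r)` and `q²·B(r)` are rational integers. -/
theorem stmt_18 (q : ℕ) (hq : 0 < q) (C D : ℤ)
    (hC : 0 ≤ C) (hCq : C ≤ (q:ℤ) - 1) (hD : 0 ≤ D) (hDq : D ≤ (q:ℤ) - 1)
    (s : ℕ) (hs : 1 ≤ s) (α β : ℕ → ℤ)
    (hαper : ∀ i, α (i + s) = α i) (hβper : ∀ i, β (i + s) = β i)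
    (r : ℕ) (hr : r ≤ q - 1)
    (t : ℕ) (htodd : Odd s → t = s) (hteven : Even s → 2 * t = s)
    (γ τ : ℕ → ℤ) (hγ1 : ∀ i, 1 ≤ γ i) (hγq : ∀ i, γ i ≤ (q:ℤ))
    (hγτ : ∀ i, α i * r + β i = (q:ℤ) * τ i + γ i)
    (Γ' : ℕ → ℤ) (hΓ0 : Γ' 0 = 0) (hΓrec : ∀ j : ℕ, Γ' (j+1) = Γ' j + γ (2*j+1))
    (c : ℤ → ℤ)
    (hcΓ : ∀ i : ℤ, 0 ≤ i → ∀ j : ℕ, i = Γ' j → c i = γ (2*j) + 2)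
    (hcn : ∀ i : ℤ, 0 ≤ i → (¬ ∃ j : ℕ, i = Γ' j) → c i = 2)
    (ν : ℤ → ℝ)
    (hνm1 : ν (-1) = 1 - (C:ℝ)/q) (hν0 : ν 0 = ufrac ((D:ℝ)/q))
    (hνrec : ∀ i : ℤ, 0 ≤ i → ν (i+1) = ufrac ((c i : ℝ) * ν i - ν (i-1)))
    (d : ℕ → ℝ) (hd : ∀ l : ℕ, d l = ufrac (ν (Γ' l + 1) - ν (Γ' l))) :
    (∀ i : ℤ, -1 ≤ i → (∃ z : ℤ, ν i = (z : ℝ)/q) ∧ 0 < ν i ∧ ν i ≤ 1) ∧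
    (∀ l : ℕ, (∃ z : ℤ, d l = (z : ℝ)/q) ∧ 0 < d l ∧ d l ≤ 1) ∧
    (∃ zA : ℤ, (q:ℝ)^2 *
        (∑ l ∈ Finset.Icc 1 t,
            (-12 * B1 (ν (Γ' l)) * B1 (ν (Γ' l - 1))
              + 6 * (((α (2*l) * r + β (2*l) : ℤ) : ℝ) + 2) * B2 (ν (Γ' l)))
          + ∑ l ∈ Finset.range t,
            (6 * (((γ (2*l+1) : ℝ) - 1) * (d l)^2
                  + (1 - 2 * d l) * ipart (ν (Γ' l) + d l * ((γ (2*l+1) : ℝ) - 1))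
                  + B2 (ν (Γ' (l+1) - 1)) - B2 (ν (Γ' l)))
              - (γ (2*l+1) : ℝ) + 1
              + (τ (2*l+1) : ℝ) *
                  (6 * ((q:ℝ) * (d l)^2
                    + (1 - 2 * d l) * ipart (ν (Γ' l) + d l * q)) - q))) = (zA : ℝ)) ∧
    (∃ zB : ℤ, (q:ℝ)^2 *
        (∑ l ∈ Finset.Icc 1 t, 6 * (q:ℝ) * (α (2*l) : ℝ) * B2 (ν (Γ' l))
          + ∑ l ∈ Finset.range t,
            (α (2*l+1) : ℝ) *
              (6 * ((q:ℝ) * (d l)^2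
                + (1 - 2 * d l) * ipart (ν (Γ' l) + d l * q)) - q)) = (zB : ℝ)) := by
  have hq' : (q : ℝ) ≠ 0 := by positivity
  have hqpos : (0 : ℝ) < q := by positivity
  have hcurr : ∀ n : ℕ, ((∃ z : ℤ, ν ((n : ℤ) - 1) = (z : ℝ) / q) ∧
        0 < ν ((n : ℤ) - 1) ∧ ν ((n : ℤ) - 1) ≤ 1) ∧
      ((∃ z : ℤ, ν n = (z : ℝ) / q) ∧ 0 < ν n ∧ ν n ≤ 1) := by
    intro n
    induction n with
    | zero =>
      have hC0 : (0 : ℝ) ≤ C := by exact_mod_cast hC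
      have hClt : (C : ℝ) < q := by exact_mod_cast (by lia : C < (q : ℤ))
      simp only [Nat.cast_zero, zero_sub, hνm1, hν0]
      refine ⟨⟨⟨q - C, ?_⟩, ?_, ?_⟩, exists_ufrac_eq_div hq ⟨D, rfl⟩, ufrac_pos _, ufrac_le_one _⟩
      · push_cast
        field_simp
      · rw [sub_pos, div_lt_one hqpos]
        exact hClt
      · have : 0 ≤ (C : ℝ) / q := by positivity
        linarith
    | succ n ih =>
      obtain ⟨⟨⟨X, hX⟩, -⟩, hn⟩ := ih
      obtain ⟨⟨Y, hY⟩, -⟩ := id hn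
      have hstep := hνrec n (by positivity)
      rw [Nat.cast_succ, add_sub_cancel_right]
      refine ⟨hn, ?_⟩
      rw [hstep]
      refine ⟨exists_ufrac_eq_div hq ⟨c n * Y - X, ?_⟩, ufrac_pos _, ufrac_le_one _⟩
      rw [hX, hY]
      push_cast
      field_simp
  have hν : ∀ i : ℤ, -1 ≤ i → (∃ z : ℤ, ν i = (z : ℝ) / q) ∧ 0 < ν i ∧ ν i ≤ 1 := by
    intro i hi
    obtain ⟨n, hn⟩ := Int.eq_ofNat_of_zero_le (by lia : 0 ≤ i + 1)
    obtain rfl : i = (n : ℤ) - 1 := by lia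
    exact (hcurr n).1
  have hΓ : ∀ l, 0 ≤ Γ' l := by
    intro l
    induction l with
    | zero => exact hΓ0.ge
    | succ l ih =>
      have := hγ1 (2 * l + 1)
      rw [hΓrec]
      lia
  have hνΓ : ∀ l, ∃ z : ℤ, ν (Γ' l) = (z : ℝ) / q := fun l =>
    (hν _ (by have := hΓ l; lia)).1
  have hνΓ' : ∀ l, ∃ z : ℤ, ν (Γ' l - 1) = (z : ℝ) / q := fun l =>
    (hν _ (by have := hΓ l; lia)).1
  have hdq : ∀ l, ∃ z : ℤ, d l = (z : ℝ) / q := by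
    intro l
    obtain ⟨X, hX⟩ := hνΓ l
    obtain ⟨Y, hY⟩ := (hν (Γ' l + 1) (by have := hΓ l; lia)).1
    rw [hd]
    refine exists_ufrac_eq_div hq ⟨Y - X, ?_⟩
    rw [hX, hY]
    push_cast
    ring
  refine ⟨hν, fun l => ⟨hdq l, hd l ▸ ufrac_pos _, hd l ▸ ufrac_le_one _⟩, ?_, ?_⟩
  · refine exists_mul_sum_add_sum_eq _ _ _ _ _ (fun l => ?_) (fun l => ?_)
    · obtain ⟨u, hu⟩ := exists_sq_mul_B1_mul_B1_eq hq (hνΓ l) (hνΓ' l)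
      obtain ⟨v, hv⟩ := exists_sq_mul_B2_eq hq (hνΓ l)
      refine ⟨-u + (α (2 * l) * r + β (2 * l) + 2) * v, ?_⟩
      push_cast
      rw [← hu, ← hv]
      ring
    · obtain ⟨u, hu⟩ := exists_sq_mul_quadratic_eq hq (hdq l) (γ (2 * l + 1) - 1)
        (ν (Γ' l) + d l * ((γ (2 * l + 1) : ℝ) - 1))
      obtain ⟨v, hv⟩ := exists_sq_mul_quadratic_eq hq (hdq l) q (ν (Γ' l) + d l * q)
      obtain ⟨w, hw⟩ := exists_sq_mul_B2_eq hq (hνΓ' (l + 1))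
      obtain ⟨w', hw'⟩ := exists_sq_mul_B2_eq hq (hνΓ l)
      refine ⟨6 * u + w - w' + q ^ 2 * (1 - γ (2 * l + 1))
        + τ (2 * l + 1) * (6 * v - q ^ 2 * q), ?_⟩
      push_cast at hu hv ⊢
      rw [← hu, ← hv, ← hw, ← hw']
      ring
  · refine exists_mul_sum_add_sum_eq _ _ _ _ _ (fun l => ?_) (fun l => ?_)
    · obtain ⟨v, hv⟩ := exists_sq_mul_B2_eq hq (hνΓ l)
      refine ⟨q * α (2 * l) * v, ?_⟩
      push_cast
      rw [← hv]
      ring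
    · obtain ⟨v, hv⟩ := exists_sq_mul_quadratic_eq hq (hdq l) q (ν (Γ' l) + d l * q)
      refine ⟨α (2 * l + 1) * (6 * v - q ^ 2 * q), ?_⟩
      push_cast at hv ⊢
      rw [← hv]
      ring
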